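/- Let (K₁, K₂, K₃) and (K₁', K₂', K₃') be triples in SU(2) with K₁K₂K₃ = 1 and K₁'K₂'K₃' = 1, and suppose arccos(Re(tr Kᵢ)/2) = arccos(Re(tr Kᵢ')/2) for i = 1, 2, 3. Then there exists g ∈ SU(2) with Kᵢ' = g Kᵢ g^{-1} for i = 1, 2, 3. -/

import Mathlib

open Matrix Real

namespace SU2Aux

open Quaternion

/-- The standard embedding of the quaternions into complex 2×2 matrices. -/
noncomputable def phi (q : ℍ[ℝ]) : Matrix (Fin 2) (Fin 2) ℂ :=
  !![⟨q.re, q.imI⟩, ⟨q.imJ, q.imK⟩; ⟨-q.imJ, q.imK⟩, ⟨q.re, -q.imI⟩]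

lemma exq (r i j k : ℝ) :
    ∃ q : ℍ[ℝ], q.re = r ∧ q.imI = i ∧ q.imJ = j ∧ q.imK = k :=
  ⟨⟨r, i, j, k⟩, rfl, rfl, rfl, rfl⟩

lemma phi_mul (p q : ℍ[ℝ]) : phi (p * q) = phi p * phi q := by
  ext i j
  fin_cases i <;> fin_cases j <;>
    simp [phi, Matrix.mul_apply, Fin.sum_univ_two, Complex.ext_iff] <;> constructor <;> ring

lemma phi_one : phi 1 = 1 := by
  ext i j
  fin_cases i <;> fin_cases j <;> simp [phi, Complex.ext_iff]

lemma phi_star (q : ℍ[ℝ]) : phi (star q) = star (phi q) := by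
  ext i j
  fin_cases i <;> fin_cases j <;> simp [phi, Complex.ext_iff]

lemma phi_inj {p q : ℍ[ℝ]} (h : phi p = phi q) : p = q := by
  have h0 := congrFun (congrFun h 0) 0
  have h1 := congrFun (congrFun h 0) 1
  simp [phi] at h0 h1
  ext
  · exact h0.1
  · exact h0.2
  · exact h1.1
  · exact h1.2

lemma phi_trace (q : ℍ[ℝ]) : (Matrix.trace (phi q)).re / 2 = q.re := by
  simp [phi, Matrix.trace, Fin.sum_univ_two]

lemma phi_mem (q : ℍ[ℝ]) (h : normSq q = 1) :
    phi q ∈ Matrix.specialUnitaryGroup (Fin 2) ℂ := by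
  rw [Matrix.mem_specialUnitaryGroup_iff, Matrix.mem_unitaryGroup_iff]
  constructor
  · rw [← phi_star, ← phi_mul, Quaternion.self_mul_star, h]
    simpa using phi_one
  · rw [Quaternion.normSq_def'] at h
    simp [phi, Matrix.det_fin_two, Complex.ext_iff]
    constructor
    · linarith
    · ring

lemma exists_phi {K : Matrix (Fin 2) (Fin 2) ℂ}
    (hK : K ∈ Matrix.specialUnitaryGroup (Fin 2) ℂ) :
    ∃ q : ℍ[ℝ], normSq q = 1 ∧ phi q = K := by
  rw [Matrix.mem_specialUnitaryGroup_iff, Matrix.mem_unitaryGroup_iff] at hK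
  obtain ⟨hu, hd⟩ := hK
  have hadj : star K = K.adjugate := by
    calc star K = (K.adjugate * K) * star K := by rw [Matrix.adjugate_mul, hd]; simp
      _ = K.adjugate := by rw [mul_assoc, hu, mul_one]
  rw [Matrix.adjugate_fin_two] at hadj
  have h0 := congrFun (congrFun hadj 0) 0
  have h1 := congrFun (congrFun hadj 0) 1
  simp [Matrix.star_apply, Complex.ext_iff] at h0 h1
  rw [Matrix.det_fin_two] at hd
  have hd' := congrArg Complex.re hd
  simp at hd'
  obtain ⟨q, e0, e1, e2, e3⟩ := exq (K 0 0).re (K 0 0).im (K 0 1).re (K 0 1).im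
  refine ⟨q, ?_, ?_⟩
  · rw [Quaternion.normSq_def', e0, e1, e2, e3]
    rw [← h0.1, ← h0.2, h1.1] at hd'
    have := h1.2
    rw [this] at hd'
    linarith
  · ext i j
    fin_cases i <;> fin_cases j <;> simp [phi, Complex.ext_iff, e0, e1, e2, e3] <;> constructor <;> linarith

/-- Quaternions with equal real part and norm are conjugate. -/
lemma step1 (a a' : ℍ[ℝ]) (hr : a'.re = a.re) (hn : normSq a' = normSq a) :
    ∃ g : ℍ[ℝ], g ≠ 0 ∧ g * a = a' * g := by
  rw [Quaternion.normSq_def', Quaternion.normSq_def', hr] at hn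
  by_cases h : a' = star a
  · subst h
    by_cases h2 : a.imI = 0 ∧ a.imJ = 0
    · obtain ⟨q, e0, e1, e2, e3⟩ := exq 0 1 0 0
      refine ⟨q, fun h => by simp [h] at e1, ?_⟩
      ext <;> simp [h2.1, h2.2, e0, e1, e2, e3]
    · obtain ⟨q, e0, e1, e2, e3⟩ := exq 0 (-a.imJ) a.imI 0
      refine ⟨q, fun h => h2 ⟨?_, ?_⟩, ?_⟩
      · simpa [h] using e2.symm
      · simpa [h] using e1
      · ext <;> simp [e0, e1, e2, e3] <;> ring
  · refine ⟨a' - star a, sub_ne_zero.2 h, ?_⟩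
    ext <;> simp [hr] <;> linarith

/-- Adjusting the second element inside the centralizer of the first. -/
lemma step2 (a b b' : ℍ[ℝ]) (hr : b'.re = b.re) (hn : normSq b' = normSq b)
    (hm : (a * b').re = (a * b).re) :
    ∃ g : ℍ[ℝ], g ≠ 0 ∧ g * a = a * g ∧ g * b = b' * g := by
  by_cases hu : a.imI = 0 ∧ a.imJ = 0 ∧ a.imK = 0
  · obtain ⟨g, hg, h⟩ := step1 b b' hr hn
    refine ⟨g, hg, ?_, h⟩
    ext <;> simp [hu.1, hu.2.1, hu.2.2] <;> ring
  rw [Quaternion.normSq_def', Quaternion.normSq_def', hr] at hn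
  simp [hr] at hm
  by_cases hb : b = b'
  · subst hb
    exact ⟨1, one_ne_zero, by simp, by simp⟩
  obtain ⟨u1, eu1⟩ : ∃ x, a.imI = x := ⟨_, rfl⟩
  obtain ⟨u2, eu2⟩ : ∃ x, a.imJ = x := ⟨_, rfl⟩
  obtain ⟨u3, eu3⟩ : ∃ x, a.imK = x := ⟨_, rfl⟩
  obtain ⟨v1, ev1⟩ : ∃ x, b.imI = x := ⟨_, rfl⟩
  obtain ⟨v2, ev2⟩ : ∃ x, b.imJ = x := ⟨_, rfl⟩
  obtain ⟨v3, ev3⟩ : ∃ x, b.imK = x := ⟨_, rfl⟩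
  obtain ⟨w1, ew1⟩ : ∃ x, b'.imI = x := ⟨_, rfl⟩
  obtain ⟨w2, ew2⟩ : ∃ x, b'.imJ = x := ⟨_, rfl⟩
  obtain ⟨w3, ew3⟩ : ∃ x, b'.imK = x := ⟨_, rfl⟩
  rw [eu1, eu2, eu3] at hu
  simp only [eu1, eu2, eu3, ev1, ev2, ev3, ew1, ew2, ew3] at hn hm
  obtain ⟨p1, hp1⟩ : ∃ p, p = v1 - w1 := ⟨_, rfl⟩
  obtain ⟨p2, hp2⟩ : ∃ p, p = v2 - w2 := ⟨_, rfl⟩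
  obtain ⟨p3, hp3⟩ : ∃ p, p = v3 - w3 := ⟨_, rfl⟩
  obtain ⟨q1, hq1⟩ : ∃ p, p = v1 + w1 := ⟨_, rfl⟩
  obtain ⟨q2, hq2⟩ : ∃ p, p = v2 + w2 := ⟨_, rfl⟩
  obtain ⟨q3, hq3⟩ : ∃ p, p = v3 + w3 := ⟨_, rfl⟩
  have hpu : p1 * u1 + p2 * u2 + p3 * u3 = 0 := by rw [hp1, hp2, hp3]; linarith
  have hpq : p1 * q1 + p2 * q2 + p3 * q3 = 0 := by rw [hp1, hp2, hp3, hq1, hq2, hq3]; linarith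
  obtain ⟨c, hc⟩ : ∃ c, c = p1 ^ 2 + p2 ^ 2 + p3 ^ 2 := ⟨_, rfl⟩
  obtain ⟨s, hs⟩ : ∃ s, s = p1 * (q2 * u3 - q3 * u2) + p2 * (q3 * u1 - q1 * u3)
    + p3 * (q1 * u2 - q2 * u1) := ⟨_, rfl⟩
  have hc0 : c ≠ 0 := by
    intro h0
    apply hb
    have e1 : p1 = 0 := pow_eq_zero_iff two_ne_zero |>.1 <| by linarith [sq_nonneg p1, sq_nonneg p2, sq_nonneg p3]
    have e2 : p2 = 0 := pow_eq_zero_iff two_ne_zero |>.1 <| by linarith [sq_nonneg p1, sq_nonneg p2, sq_nonneg p3]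
    have e3 : p3 = 0 := pow_eq_zero_iff two_ne_zero |>.1 <| by linarith [sq_nonneg p1, sq_nonneg p2, sq_nonneg p3]
    ext <;> linarith
  have k1 : s * p1 = c * (q2 * u3 - q3 * u2) := by
    rw [hs, hc]
    linear_combination (p2 * q3 - p3 * q2) * hpu - (p2 * u3 - p3 * u2) * hpq
  have k2 : s * p2 = c * (q3 * u1 - q1 * u3) := by
    rw [hs, hc]
    linear_combination (p3 * q1 - p1 * q3) * hpu - (p3 * u1 - p1 * u3) * hpq
  have k3 : s * p3 = c * (q1 * u2 - q2 * u1) := by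
    rw [hs, hc]
    linear_combination (p1 * q2 - p2 * q1) * hpu - (p1 * u2 - p2 * u1) * hpq
  clear hs hc
  obtain ⟨q, e0, e1, e2, e3⟩ := exq s (c * u1) (c * u2) (c * u3)
  refine ⟨q, fun h => hu ⟨?_, ?_, ?_⟩, ?_, ?_⟩
  · simpa [hc0, h] using e1.symm
  · simpa [hc0, h] using e2.symm
  · simpa [hc0, h] using e3.symm
  · ext <;> simp [e0, e1, e2, e3, eu1, eu2, eu3] <;> ring
  · subst hp1 hp2 hp3 hq1 hq2 hq3
    ext <;> simp [e0, e1, e2, e3, ev1, ev2, ev3, ew1, ew2, ew3, hr]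
    · linear_combination -c * hpu
    · linear_combination k1
    · linear_combination k2
    · linear_combination k3

lemma conj_pair (a b a' b' : ℍ[ℝ]) (har : a'.re = a.re) (han : normSq a' = normSq a)
    (hbr : b'.re = b.re) (hbn : normSq b' = normSq b) (hm : (a' * b').re = (a * b).re) :
    ∃ g : ℍ[ℝ], g ≠ 0 ∧ g * a = a' * g ∧ g * b = b' * g := by
  obtain ⟨h, h0, hh⟩ := step1 a a' har han
  have ea : a' = h * a * h⁻¹ := by rw [hh]; simp [mul_assoc, h0]
  have hre : ∀ x : ℍ[ℝ], (h⁻¹ * x * h).re = x.re := by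
    intro x
    have hcomm : ∀ x y : ℍ[ℝ], (x * y).re = (y * x).re := by
      intro x y; simp; ring
    rw [hcomm, ← mul_assoc, mul_inv_cancel₀ h0, one_mul]
  obtain ⟨k, k0, ka, kb⟩ := step2 a b (h⁻¹ * b' * h) (by rw [hre, hbr])
    (by
      have : normSq h ≠ 0 := by simpa using h0
      simp only [map_mul, map_inv₀, hbn]; field_simp)
    (by
      have e : h⁻¹ * (a' * b') * h = a * (h⁻¹ * b' * h) := by
        rw [ea]; simp only [mul_assoc, inv_mul_cancel_left₀ h0]
      rw [← hm, ← hre (a' * b'), e])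
  refine ⟨h * k, mul_ne_zero h0 k0, ?_, ?_⟩
  · rw [mul_assoc, ka, ← mul_assoc, hh, mul_assoc]
  · rw [mul_assoc, kb]; simp [← mul_assoc, h0]

lemma re_eq {p q : ℍ[ℝ]} (hp : normSq p = 1) (hq : normSq q = 1)
    (h : Real.arccos ((Matrix.trace (phi p)).re / 2)
      = Real.arccos ((Matrix.trace (phi q)).re / 2)) : p.re = q.re := by
  have key : ∀ q : ℍ[ℝ], normSq q = 1 → q.re ∈ Set.Icc (-1 : ℝ) 1 := by
    intro q hq
    rw [Quaternion.normSq_def'] at hq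
    rw [Set.mem_Icc, ← abs_le, ← sq_le_one_iff_abs_le_one]
    nlinarith [sq_nonneg q.imI, sq_nonneg q.imJ, sq_nonneg q.imK]
  rw [phi_trace, phi_trace] at h
  exact Real.arccos_injOn (key p hp) (key q hq) h

lemma third {a b c : ℍ[ℝ]} (h : phi a * phi b * phi c = 1) : c = (a * b)⁻¹ := by
  rw [← phi_mul, ← phi_mul, ← phi_one] at h
  exact eq_inv_of_mul_eq_one_right (phi_inj h)

end SU2Aux



/-- Two triples `(K₁,K₂,K₃)`, `(K₁',K₂',K₃')` in `SU(2)` with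
`K₁K₂K₃ = 1 = K₁'K₂'K₃'` and the same angles `arccos(Re(tr Kᵢ)/2)` are simultaneously
conjugate by an element of `SU(2)`. -/
theorem su2_triples_with_equal_angles_conjugate
    (K₁ K₂ K₃ K₁' K₂' K₃' : Matrix (Fin 2) (Fin 2) ℂ)
    (h₁ : K₁ ∈ Matrix.specialUnitaryGroup (Fin 2) ℂ)
    (h₂ : K₂ ∈ Matrix.specialUnitaryGroup (Fin 2) ℂ)
    (h₃ : K₃ ∈ Matrix.specialUnitaryGroup (Fin 2) ℂ)
    (h₁' : K₁' ∈ Matrix.specialUnitaryGroup (Fin 2) ℂ)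
    (h₂' : K₂' ∈ Matrix.specialUnitaryGroup (Fin 2) ℂ)
    (h₃' : K₃' ∈ Matrix.specialUnitaryGroup (Fin 2) ℂ)
    (hprod : K₁ * K₂ * K₃ = 1) (hprod' : K₁' * K₂' * K₃' = 1)
    (ha₁ : Real.arccos ((Matrix.trace K₁').re / 2) = Real.arccos ((Matrix.trace K₁).re / 2))
    (ha₂ : Real.arccos ((Matrix.trace K₂').re / 2) = Real.arccos ((Matrix.trace K₂).re / 2))
    (ha₃ : Real.arccos ((Matrix.trace K₃').re / 2) = Real.arccos ((Matrix.trace K₃).re / 2)) :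
    ∃ g ∈ Matrix.specialUnitaryGroup (Fin 2) ℂ,
      K₁' = g * K₁ * g⁻¹ ∧ K₂' = g * K₂ * g⁻¹ ∧ K₃' = g * K₃ * g⁻¹ := by
  obtain ⟨a, na, rfl⟩ := SU2Aux.exists_phi h₁
  obtain ⟨b, nb, rfl⟩ := SU2Aux.exists_phi h₂
  obtain ⟨c, nc, rfl⟩ := SU2Aux.exists_phi h₃
  obtain ⟨a', na', rfl⟩ := SU2Aux.exists_phi h₁'
  obtain ⟨b', nb', rfl⟩ := SU2Aux.exists_phi h₂'
  obtain ⟨c', nc', rfl⟩ := SU2Aux.exists_phi h₃'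
  have ra := SU2Aux.re_eq na' na ha₁
  have rb := SU2Aux.re_eq nb' nb ha₂
  have rc := SU2Aux.re_eq nc' nc ha₃
  have ec := SU2Aux.third hprod
  have ec' := SU2Aux.third hprod'
  have nab : Quaternion.normSq (a * b) = 1 := by rw [map_mul, na, nb, one_mul]
  have nab' : Quaternion.normSq (a' * b') = 1 := by rw [map_mul, na', nb', one_mul]
  have hm : (a' * b').re = (a * b).re := by
    rw [ec, ec', Quaternion.inv_def, Quaternion.inv_def, nab, nab', inv_one, one_smul, one_smul,
      Quaternion.re_star, Quaternion.re_star] at rc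
    exact rc
  obtain ⟨g, g0, ga, gb⟩ := SU2Aux.conj_pair a b a' b' ra (na'.trans na.symm) rb
    (nb'.trans nb.symm) hm
  -- the third relation follows from the first two
  have gc : g * c = c' * g := by
    have hab : g * (a * b) = (a' * b') * g := by
      rw [← mul_assoc, ga, mul_assoc, gb, mul_assoc]
    have h1 : a * b ≠ 0 := by intro h; rw [h] at nab; simp at nab
    have h2 : a' * b' ≠ 0 := by intro h; rw [h] at nab'; simp at nab'
    rw [ec, ec', eq_inv_mul_iff_mul_eq₀ h2, ← mul_assoc, ← hab, mul_assoc,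
      mul_inv_cancel₀ h1, mul_one]
  -- normalize
  have hg : ‖g‖ ≠ 0 := norm_ne_zero_iff.2 g0
  obtain ⟨k, hk⟩ : ∃ k, k = ‖g‖⁻¹ • g := ⟨_, rfl⟩
  have nk : Quaternion.normSq k = 1 := by
    rw [Quaternion.normSq_eq_norm_mul_self, hk, norm_smul, norm_inv, norm_norm,
      inv_mul_cancel₀ hg, one_mul]
  have hmem := SU2Aux.phi_mem k nk
  have fin : ∀ x x', g * x = x' * g →
      SU2Aux.phi x' = SU2Aux.phi k * SU2Aux.phi x * (SU2Aux.phi k)⁻¹ := by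
    intro x x' h
    have hkx : k * x = x' * k := by rw [hk, smul_mul_assoc, mul_smul_comm, h]
    have hdet : IsUnit (SU2Aux.phi k).det := by
      rw [(Matrix.mem_specialUnitaryGroup_iff.1 hmem).2]; exact isUnit_one
    rw [← SU2Aux.phi_mul, hkx, SU2Aux.phi_mul, Matrix.mul_nonsing_inv_cancel_right _ _ hdet]
  exact ⟨SU2Aux.phi k, hmem, fin a a' ga, fin b b' gb, fin c c' gc⟩
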